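/- arXiv:1008.4419 — 2 statements merged into one kernel-verified Lean document; each statement's English description precedes it below -/
import Mathlib

section
/- On X = Y = [0,1) with λ the Lebesgue measure, let f₀(x) = x and f₁(x) = x + √2 (mod 1), and set γᵢ = (id × fᵢ)_# λ for i = 0, 1. Then the measure γ := ½(γ₀ + γ₁) belongs to Γ(λ,λ), vanishes outside the acyclic set S = Graph(f₀) ∪ Graph(f₁), but is not extremal in Γ(λ,λ). -/
open MeasureTheory
open scoped NNReal ENNReal

/-- A set `S ⊆ X × Y` is **acyclic** if for every `k ≥ 2` distinct points
`x₁,…,x_k ∈ X` and distinct points `y₁,…,y_k ∈ Y`, at least one of the pairs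
`(x₁,y₁), (x₁,y₂), (x₂,y₂), …, (x_{k-1},y_k), (x_k,y_k), (x_k,y₁)` lies outside `S`. -/
def Acyclic {X Y : Type*} (S : Set (X × Y)) : Prop :=
  ∀ (k : ℕ) (x : Fin (k + 2) → X) (y : Fin (k + 2) → Y),
    Function.Injective x → Function.Injective y →
    ∃ i : Fin (k + 2), (x i, y i) ∉ S ∨ (x i, y (i + 1)) ∉ S

/-- `Γ(μ,ν)`: the set of non-negative Borel measures on `X × Y` with marginals `μ` and `ν`. -/
def IsCoupling {X Y : Type*} [MeasurableSpace X] [MeasurableSpace Y]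
    (γ : Measure (X × Y)) (μ : Measure X) (ν : Measure Y) : Prop :=
  γ.map Prod.fst = μ ∧ γ.map Prod.snd = ν

/-- `γ` is extremal in the convex set `Γ(μ,ν)`. -/
def IsExtremalCoupling {X Y : Type*} [MeasurableSpace X] [MeasurableSpace Y]
    (γ : Measure (X × Y)) (μ : Measure X) (ν : Measure Y) : Prop :=
  IsCoupling γ μ ν ∧
    ∀ (γ₀ γ₁ : Measure (X × Y)) (t : ℝ≥0), 0 < t → t < 1 →
      IsCoupling γ₀ μ ν → IsCoupling γ₁ μ ν →
      γ = (1 - t) • γ₀ + t • γ₁ → γ₀ = γ₁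

/-- The map `f₁(x) = x + √2 (mod 1)` on `[0,1)`. -/
noncomputable def addSqrtTwoMod1 : Set.Ico (0 : ℝ) 1 → Set.Ico (0 : ℝ) 1 :=
  fun x => ⟨Int.fract ((x : ℝ) + Real.sqrt 2), Int.fract_nonneg _, Int.fract_lt_one _⟩

/-- Lebesgue measure on `[0,1)`. -/
noncomputable def lebIco : Measure (Set.Ico (0 : ℝ) 1) :=
  (volume : Measure ℝ).comap Subtype.val

theorem volume_fract_preimage_inter_Ico (s : Set ℝ) (hs : MeasurableSet s) (a : ℝ) :
    volume (Int.fract ⁻¹' s ∩ Set.Ico a (a + 1)) = volume (s ∩ Set.Ico 0 1) := by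
  have key := (isAddFundamentalDomain_Ioc one_pos a).measure_set_eq (μ := volume)
    (isAddFundamentalDomain_Ioc one_pos 0) (A := Int.fract ⁻¹' s) (measurable_fract hs) (by
      rintro ⟨g, hg⟩
      obtain ⟨n, rfl⟩ := AddSubgroup.mem_zmultiples_iff.1 hg
      ext x
      simp [AddSubgroup.vadd_def])
  have hae (b : ℝ) : volume (Int.fract ⁻¹' s ∩ Set.Ico b (b + 1)) =
      volume (Int.fract ⁻¹' s ∩ Set.Ioc b (b + 1)) :=
    measure_congr ((ae_eq_refl _).inter Ico_ae_eq_Ioc)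
  rw [hae, key, ← hae, zero_add]
  congr 1
  ext x
  simp only [Set.mem_inter_iff, Set.mem_preimage]
  exact and_congr_left fun hx => by rw [Int.fract_eq_self.2 hx]

theorem measurable_addSqrtTwoMod1 : Measurable addSqrtTwoMod1 :=
  (measurable_fract.comp (measurable_subtype_coe.add_const _)).subtype_mk

theorem lebIco_apply (s : Set (Set.Ico (0 : ℝ) 1)) :
    lebIco s = volume (Subtype.val '' s) :=
  comap_subtype_coe_apply measurableSet_Ico volume s

theorem measurePreserving_addSqrtTwoMod1 : MeasurePreserving addSqrtTwoMod1 lebIco lebIco := by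
  refine ⟨measurable_addSqrtTwoMod1, Measure.ext fun t ht => ?_⟩
  obtain ⟨s, hs, rfl⟩ := ht
  rw [Measure.map_apply measurable_addSqrtTwoMod1 (measurable_subtype_coe hs), lebIco_apply,
    lebIco_apply, Subtype.image_preimage_coe, Set.inter_comm (Set.Ico 0 1) s,
    ← volume_fract_preimage_inter_Ico s hs √2, ← measure_preimage_add_right volume √2
      (Int.fract ⁻¹' s ∩ Set.Ico √2 (√2 + 1))]
  congr 1
  ext x
  simp only [Set.mem_image, Set.mem_preimage, Set.mem_inter_iff, Set.mem_Ico]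
  constructor
  · rintro ⟨y, hy, rfl⟩
    exact ⟨hy, by linarith [y.2.1], by linarith [y.2.2]⟩
  · rintro ⟨hx, h0, h1⟩
    exact ⟨⟨x, by linarith, by linarith⟩, hx, rfl⟩

instance : IsProbabilityMeasure lebIco := ⟨by
  rw [lebIco_apply, Set.image_univ, Subtype.range_coe, Real.volume_Ico]; simp⟩

theorem coe_addSqrtTwoMod1 (x : Set.Ico (0 : ℝ) 1) :
    (addSqrtTwoMod1 x : ℝ) = x + √2 - ⌊(x : ℝ) + √2⌋ := rfl

theorem injective_addSqrtTwoMod1 : Function.Injective addSqrtTwoMod1 := by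
  intro x y h
  obtain ⟨n, hn⟩ := Int.fract_eq_fract.1 (congrArg Subtype.val h)
  have hxy : (x : ℝ) - y = n := by linarith
  have h1 : (n : ℝ) < 1 := by linarith [x.2.2, y.2.1]
  have h2 : (-1 : ℝ) < n := by linarith [x.2.1, y.2.2]
  have hn0 : n = 0 := by
    have h1' : n < 1 := by exact_mod_cast h1
    have h2' : -1 < n := by exact_mod_cast h2
    omega
  rw [hn0, Int.cast_zero] at hxy
  exact Subtype.ext (sub_eq_zero.1 hxy)

theorem sum_addSqrtTwoMod1_ne {ι : Type*} [Fintype ι] [Nonempty ι] (x : ι → Set.Ico (0 : ℝ) 1) :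
    ∑ i, (addSqrtTwoMod1 (x i) : ℝ) ≠ ∑ i, (x i : ℝ) := by
  intro h
  simp only [coe_addSqrtTwoMod1, Finset.sum_sub_distrib, Finset.sum_add_distrib, Finset.sum_const,
    nsmul_eq_mul, Finset.card_univ] at h
  have hirr : Irrational ((Fintype.card ι : ℕ) * √2) :=
    irrational_sqrt_two.natCast_mul Fintype.card_ne_zero
  refine hirr.ne_int (∑ i, ⌊(x i : ℝ) + √2⌋) ?_
  push_cast
  linarith

theorem addSqrtTwoMod1_ne (x : Set.Ico (0 : ℝ) 1) : addSqrtTwoMod1 x ≠ x := fun h =>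
  sum_addSqrtTwoMod1_ne (fun _ : Unit => x) (by simp [h])

theorem acyclic_graph_union_graph_addSqrtTwoMod1 :
    Acyclic (({p | p.2 = p.1} ∪ {p | p.2 = addSqrtTwoMod1 p.1}) :
      Set (Set.Ico (0 : ℝ) 1 × Set.Ico (0 : ℝ) 1)) := by
  intro k x y hx hy
  by_contra! h
  simp only [Set.mem_union, Set.mem_ofPred_eq] at h
  have hne (i : Fin (k + 2)) : y (i + 1) ≠ y i := fun e => by simpa using hy e
  have hshift : ∑ i, (y (i + 1) : ℝ) = ∑ i, (y i : ℝ) :=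
    Equiv.sum_comp (Equiv.addRight 1) fun i => (y i : ℝ)
  have hstep (i : Fin (k + 2)) (hi : y i = x i) : y (i + 1) = x (i + 1) := by
    refine (h (i + 1)).1.resolve_right fun h1 => ?_
    rcases (h i).2 with h2 | h2
    · exact hne i (h2.trans hi.symm)
    · simpa using hx (injective_addSqrtTwoMod1 (h1.symm.trans h2))
  by_cases hex : ∃ i, y i = x i
  · obtain ⟨i, hi⟩ := hex
    have hall (n : ℕ) : y (i + Fin.ofNat (k + 2) n) = x (i + Fin.ofNat (k + 2) n) := by
      induction n with
      | zero => simpa using hi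
      | succ n ih =>
        have hcast : Fin.ofNat (k + 2) (n + 1) = Fin.ofNat (k + 2) n + 1 :=
          Fin.ext (by simp [Fin.val_add])
        rw [hcast, ← add_assoc]
        exact hstep _ ih
    have hfst (j : Fin (k + 2)) : y j = x j := by
      simpa using hall (j - i : Fin (k + 2)).val
    have hsnd (j : Fin (k + 2)) : y (j + 1) = addSqrtTwoMod1 (x j) :=
      (h j).2.resolve_left fun e => hne j (e.trans (hfst j).symm)
    refine sum_addSqrtTwoMod1_ne x ?_
    simpa only [hsnd, hfst] using hshift
  · push Not at hex
    have hfst (j : Fin (k + 2)) : y j = addSqrtTwoMod1 (x j) := (h j).1.resolve_left (hex j)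
    have hsnd (j : Fin (k + 2)) : y (j + 1) = x j :=
      (h j).2.resolve_right fun e => hne j (e.trans (hfst j).symm)
    refine sum_addSqrtTwoMod1_ne x ?_
    calc ∑ i, (addSqrtTwoMod1 (x i) : ℝ) = ∑ i, (y i : ℝ) := by simp only [hfst]
      _ = ∑ i, (y (i + 1) : ℝ) := hshift.symm
      _ = ∑ i, (x i : ℝ) := by simp only [hsnd]

theorem MeasureTheory.MeasurePreserving.isCoupling_map_graph {X Y : Type*} [MeasurableSpace X]
    [MeasurableSpace Y] {μ : Measure X} {ν : Measure Y} {f : X → Y} (hf : MeasurePreserving f μ ν) :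
    IsCoupling (μ.map fun x => (x, f x)) μ ν := by
  have hg : Measurable fun x => (x, f x) := measurable_id.prodMk hf.measurable
  constructor
  · rw [Measure.map_map measurable_fst hg]
    exact Measure.map_id
  · rw [Measure.map_map measurable_snd hg]
    exact hf.map_eq

theorem MeasureTheory.Measure.inv_two_smul_add_self {Z : Type*} [MeasurableSpace Z]
    (ρ : Measure Z) : (2 : ℝ≥0∞)⁻¹ • (ρ + ρ) = ρ := by
  rw [← two_smul ℝ≥0∞ ρ, smul_smul, ENNReal.inv_mul_cancel two_ne_zero ENNReal.ofNat_ne_top,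
    one_smul]

theorem IsCoupling.half_add {X Y : Type*} [MeasurableSpace X] [MeasurableSpace Y]
    {γ₀ γ₁ : Measure (X × Y)} {μ : Measure X} {ν : Measure Y} (h₀ : IsCoupling γ₀ μ ν)
    (h₁ : IsCoupling γ₁ μ ν) : IsCoupling ((2 : ℝ≥0∞)⁻¹ • (γ₀ + γ₁)) μ ν := by
  constructor
  · rw [Measure.map_smul, Measure.map_add _ _ measurable_fst, h₀.1, h₁.1,
      Measure.inv_two_smul_add_self]
  · rw [Measure.map_smul, Measure.map_add _ _ measurable_snd, h₀.2, h₁.2,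
      Measure.inv_two_smul_add_self]

/-- **An acyclic set supporting non-extremal measures.**  On `X = Y = [0,1)` with Lebesgue
measure `λ`, let `f₀(x) = x`, `f₁(x) = x + √2 (mod 1)`, and `γᵢ = (id × fᵢ)_# λ`.  Then
`γ = ½(γ₀ + γ₁)` belongs to `Γ(λ,λ)` and vanishes outside the acyclic set
`S = Graph(f₀) ∪ Graph(f₁)`, yet `γ` is not extremal in `Γ(λ,λ)`. -/
theorem acyclic_set_supporting_nonextremal_measure :
    IsCoupling ((2 : ℝ≥0∞)⁻¹ • (lebIco.map (fun x => (x, x)) +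
        lebIco.map (fun x => (x, addSqrtTwoMod1 x)))) lebIco lebIco ∧
    ((2 : ℝ≥0∞)⁻¹ • (lebIco.map (fun x => (x, x)) +
        lebIco.map (fun x => (x, addSqrtTwoMod1 x))))
      (({p | p.2 = p.1} ∪ {p | p.2 = addSqrtTwoMod1 p.1})ᶜ :
        Set (Set.Ico (0 : ℝ) 1 × Set.Ico (0 : ℝ) 1)) = 0 ∧
    Acyclic (({p | p.2 = p.1} ∪ {p | p.2 = addSqrtTwoMod1 p.1}) :
      Set (Set.Ico (0 : ℝ) 1 × Set.Ico (0 : ℝ) 1)) ∧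
    ¬ IsExtremalCoupling ((2 : ℝ≥0∞)⁻¹ • (lebIco.map (fun x => (x, x)) +
        lebIco.map (fun x => (x, addSqrtTwoMod1 x)))) lebIco lebIco := by
  have hid : Measurable fun x : Set.Ico (0 : ℝ) 1 => (x, x) := measurable_id.prodMk measurable_id
  have hgraph : Measurable fun x : Set.Ico (0 : ℝ) 1 => (x, addSqrtTwoMod1 x) :=
    measurable_id.prodMk measurable_addSqrtTwoMod1
  have hdiag : MeasurableSet {p : Set.Ico (0 : ℝ) 1 × Set.Ico (0 : ℝ) 1 | p.2 = p.1} :=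
    measurableSet_eq_fun measurable_snd measurable_fst
  have hmeas : MeasurableSet {p : Set.Ico (0 : ℝ) 1 × Set.Ico (0 : ℝ) 1 |
      p.2 = addSqrtTwoMod1 p.1} :=
    measurableSet_eq_fun measurable_snd (measurable_addSqrtTwoMod1.comp measurable_fst)
  have hc₀ : IsCoupling (lebIco.map fun x => (x, x)) lebIco lebIco :=
    (MeasurePreserving.id lebIco).isCoupling_map_graph
  have hc₁ := measurePreserving_addSqrtTwoMod1.isCoupling_map_graph
  refine ⟨hc₀.half_add hc₁, ?_, acyclic_graph_union_graph_addSqrtTwoMod1, fun hext => ?_⟩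
  · rw [Measure.smul_apply, Measure.add_apply, Measure.map_apply hid (hdiag.union hmeas).compl,
      Measure.map_apply hgraph (hdiag.union hmeas).compl]
    simp
  · have hhalf : (1 - 2⁻¹ : ℝ≥0) = 2⁻¹ := by
      rw [← NNReal.coe_inj, NNReal.coe_sub (by norm_num)]
      norm_num
    have heq := hext.2 _ _ 2⁻¹ (by norm_num) (by norm_num) hc₀ hc₁ (by
      rw [hhalf, ← smul_add]
      ext s _
      simp [ENNReal.smul_def])
    have hval := congrArg (fun ρ => ρ {p | p.2 = p.1}) heq
    simp only [Measure.map_apply hid hdiag, Measure.map_apply hgraph hdiag] at hval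
    simp [addSqrtTwoMod1_ne] at hval
end

section
/- (Beneš–Štěpán necessary condition.) Let X and Y be subsets of complete separable metric spaces equipped with Borel probability measures μ on X and ν on Y. If γ ∈ Γ(μ,ν) is extremal in Γ(μ,ν), then there exists an acyclic subset S ⊂ X × Y such that γ vanishes outside S. -/
open MeasureTheory
open scoped NNReal

open Filter Topology Set

/-- A functional of norm at most one on `L¹(γ)` gives a signed perturbation of `γ` that is still a
nonnegative measure. -/
lemma exists_measure_real_eq_add_dual {α : Type*} [MeasurableSpace α] (γ : Measure α)
    [IsFiniteMeasure γ] (ψ : StrongDual ℝ (Lp ℝ 1 γ)) (hψ : ‖ψ‖ ≤ 1) :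
    ∃ ρ : Measure α, IsFiniteMeasure ρ ∧ ∀ (A : Set α) (hA : MeasurableSet A),
      ρ.real A = γ.real A + ψ (indicatorConstLp 1 hA (measure_ne_top γ A) 1) := by
  classical
  have hbound (A : Set α) (hA : MeasurableSet A) :
      ‖ψ (indicatorConstLp 1 hA (measure_ne_top γ A) 1)‖ ≤ γ.real A := by
    calc ‖ψ (indicatorConstLp 1 hA (measure_ne_top γ A) 1)‖
        ≤ 1 * ‖indicatorConstLp 1 hA (measure_ne_top γ A) (1 : ℝ)‖ := ψ.le_of_opNorm_le hψ _
      _ = γ.real A := by rw [norm_indicatorConstLp one_ne_zero ENNReal.one_ne_top]; simp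
  let m : Set α → ℝ := fun A ↦
    if hA : MeasurableSet A then ψ (indicatorConstLp 1 hA (measure_ne_top γ A) 1) else 0
  let v : VectorMeasure α ℝ := VectorMeasure.of_additive_of_le_measure (μ := γ) m
    (fun A ↦ by
      by_cases hA : MeasurableSet A
      · simp only [m, hA, dif_pos]
        rw [← ofReal_norm, ← ofReal_measureReal]
        exact ENNReal.ofReal_le_ofReal (hbound A hA)
      · simp [m, hA])
    (fun s t hs ht hst ↦ by
      simp only [m, hs, ht, hs.union ht, dif_pos]
      rw [indicatorConstLp_disjoint_union hs ht (measure_ne_top γ s) (measure_ne_top γ t) hst,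
        map_add])
    (fun s hs ↦ by simp [m, hs])
  have hv (A : Set α) (hA : MeasurableSet A) :
      v A = ψ (indicatorConstLp 1 hA (measure_ne_top γ A) 1) := dif_pos hA
  have hnonneg : 0 ≤[univ] γ.toSignedMeasure + v := by
    rw [VectorMeasure.le_restrict_univ_iff_le]
    intro A hA
    rw [add_apply, Measure.toSignedMeasure_apply_measurable hA, hv A hA]
    have := neg_le_of_abs_le (hbound A hA)
    simp only [FunLike.coe_zero, Pi.zero_apply]
    linarith
  refine ⟨(γ.toSignedMeasure + v).toMeasureOfZeroLE univ .univ hnonneg, inferInstance,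
    fun A hA ↦ ?_⟩
  rw [SignedMeasure.toMeasureOfZeroLE_real_apply _ _ _ hA, univ_inter, add_apply,
    Measure.toSignedMeasure_apply_measurable hA, hv A hA]

section Coupling

variable {X Y : Type*} [MeasurableSpace X] [MeasurableSpace Y] {μ : Measure X} {ν : Measure Y}
  {γ : Measure (X × Y)}

lemma IsCoupling.measurePreserving_fst (h : IsCoupling γ μ ν) :
    MeasurePreserving Prod.fst γ μ := ⟨measurable_fst, h.1⟩

lemma IsCoupling.measurePreserving_snd (h : IsCoupling γ μ ν) :
    MeasurePreserving Prod.snd γ ν := ⟨measurable_snd, h.2⟩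

/-- The subspace of `L¹(γ)` of functions of the form `a(x) + b(y)`. -/
noncomputable def separatedL1 (h : IsCoupling γ μ ν) : Submodule ℝ (Lp ℝ 1 γ) :=
  LinearMap.range (Lp.compMeasurePreservingₗ ℝ Prod.fst h.measurePreserving_fst) ⊔
    LinearMap.range (Lp.compMeasurePreservingₗ ℝ Prod.snd h.measurePreserving_snd)

lemma indicator_preimage_fst_mem_separatedL1 [IsFiniteMeasure μ] [IsFiniteMeasure γ]
    (h : IsCoupling γ μ ν) {A : Set X} (hA : MeasurableSet A) :
    indicatorConstLp 1 (hA.preimage measurable_fst) (measure_ne_top γ _) (1 : ℝ) ∈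
      separatedL1 h :=
  Submodule.mem_sup_left ⟨indicatorConstLp 1 hA (measure_ne_top μ A) 1, rfl⟩

lemma indicator_preimage_snd_mem_separatedL1 [IsFiniteMeasure ν] [IsFiniteMeasure γ]
    (h : IsCoupling γ μ ν) {B : Set Y} (hB : MeasurableSet B) :
    indicatorConstLp 1 (hB.preimage measurable_snd) (measure_ne_top γ _) (1 : ℝ) ∈
      separatedL1 h :=
  Submodule.mem_sup_right ⟨indicatorConstLp 1 hB (measure_ne_top ν B) 1, rfl⟩

/-- Perturbing a coupling by a functional that annihilates the sums `a(x) + b(y)` preserves its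
marginals. -/
lemma IsCoupling.of_real_eq_add_dual [IsFiniteMeasure μ] [IsFiniteMeasure ν] [IsFiniteMeasure γ]
    (h : IsCoupling γ μ ν) {ψ : StrongDual ℝ (Lp ℝ 1 γ)} (hψ : ∀ f ∈ separatedL1 h, ψ f = 0)
    {ρ : Measure (X × Y)} [IsFiniteMeasure ρ]
    (hρ : ∀ (A : Set (X × Y)) (hA : MeasurableSet A),
      ρ.real A = γ.real A + ψ (indicatorConstLp 1 hA (measure_ne_top γ A) 1)) :
    IsCoupling ρ μ ν := by
  constructor
  · ext A hA
    rw [← h.1, Measure.map_apply measurable_fst hA, Measure.map_apply measurable_fst hA,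
      ← measureReal_eq_measureReal_iff, hρ _ (hA.preimage measurable_fst),
      hψ _ (indicator_preimage_fst_mem_separatedL1 h hA), add_zero]
  · ext B hB
    rw [← h.2, Measure.map_apply measurable_snd hB, Measure.map_apply measurable_snd hB,
      ← measureReal_eq_measureReal_iff, hρ _ (hB.preimage measurable_snd),
      hψ _ (indicator_preimage_snd_mem_separatedL1 h hB), add_zero]

/-- For an extremal coupling, a functional on `L¹(γ)` annihilating the sums `a(x) + b(y)`
annihilates all indicators. -/
lemma IsExtremalCoupling.dual_indicator_eq_zero [IsFiniteMeasure μ] [IsFiniteMeasure ν]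
    [IsFiniteMeasure γ] (h : IsExtremalCoupling γ μ ν) {ψ : StrongDual ℝ (Lp ℝ 1 γ)}
    (hψ1 : ‖ψ‖ ≤ 1) (hψ : ∀ f ∈ separatedL1 h.1, ψ f = 0) {A : Set (X × Y)}
    (hA : MeasurableSet A) :
    ψ (indicatorConstLp 1 hA (measure_ne_top γ A) 1) = 0 := by
  obtain ⟨ρ₀, hfin₀, hρ₀⟩ := exists_measure_real_eq_add_dual γ ψ hψ1
  obtain ⟨ρ₁, hfin₁, hρ₁⟩ := exists_measure_real_eq_add_dual γ (-ψ) (by rwa [norm_neg])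
  have heq : ρ₀ = ρ₁ := by
    refine h.2 ρ₀ ρ₁ (1 / 2) (by norm_num) (by rw [← NNReal.coe_lt_coe]; norm_num)
      (h.1.of_real_eq_add_dual hψ hρ₀)
      (h.1.of_real_eq_add_dual (fun f hf ↦ by simp [hψ f hf]) hρ₁) ?_
    have hhalf : (1 - 1 / 2 : ℝ≥0) = 1 / 2 := by
      rw [tsub_eq_iff_eq_add_of_le (by rw [← NNReal.coe_le_coe]; norm_num)]; norm_num
    ext B hB
    rw [← measureReal_eq_measureReal_iff, hhalf, measureReal_add_apply,
      measureReal_nnreal_smul_apply, measureReal_nnreal_smul_apply, hρ₀ B hB, hρ₁ B hB]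
    simp
    ring
  have h₀ := hρ₀ A hA
  have h₁ := hρ₁ A hA
  rw [heq, h₁, neg_apply] at h₀
  linarith

/-- For an extremal coupling `γ`, every indicator is a limit in `L¹(γ)` of sums `a(x) + b(y)`. -/
lemma IsExtremalCoupling.indicator_mem_closure [IsFiniteMeasure μ] [IsFiniteMeasure ν]
    [IsFiniteMeasure γ] (h : IsExtremalCoupling γ μ ν) {A : Set (X × Y)} (hA : MeasurableSet A) :
    indicatorConstLp 1 hA (measure_ne_top γ A) (1 : ℝ) ∈
      closure (separatedL1 h.1 : Set (Lp ℝ 1 γ)) := by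
  by_contra hnot
  obtain ⟨φ, u, hlt, hu⟩ := geometric_hahn_banach_closed_point
    (s := ((separatedL1 h.1).topologicalClosure : Set (Lp ℝ 1 γ)))
    (separatedL1 h.1).topologicalClosure.convex
    (separatedL1 h.1).isClosed_topologicalClosure hnot
  have hφ (f) (hf : f ∈ separatedL1 h.1) : φ f = 0 := by
    by_contra hne
    have := hlt _ ((separatedL1 h.1).le_topologicalClosure
      ((separatedL1 h.1).smul_mem (u / φ f) hf))
    rw [map_smul, smul_eq_mul, div_mul_cancel₀ _ hne] at this
    exact this.false
  have hu0 : 0 < u := by simpa using hlt 0 (Submodule.zero_mem _)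
  have hφ0 : 0 < ‖φ‖ := norm_pos_iff.2 fun h0 ↦ by
    rw [h0, zero_apply] at hu
    exact (hu0.trans hu).false
  have := h.dual_indicator_eq_zero (ψ := ‖φ‖⁻¹ • φ)
    (by rw [norm_smul, norm_inv, norm_norm, inv_mul_cancel₀ hφ0.ne'])
    (fun f hf ↦ by simp [hφ f hf]) hA
  rw [smul_apply, smul_eq_zero] at this
  rcases this with h0 | h0
  · exact (inv_pos.2 hφ0).ne' h0
  · exact (hu0.trans hu).ne' h0

/-- For an extremal coupling, every indicator is an almost everywhere limit of sums
`a(x) + b(y)`. -/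
lemma IsExtremalCoupling.exists_tendsto_add [IsFiniteMeasure μ] [IsFiniteMeasure ν]
    [IsFiniteMeasure γ] (h : IsExtremalCoupling γ μ ν) {A : Set (X × Y)} (hA : MeasurableSet A) :
    ∃ (a : ℕ → X → ℝ) (b : ℕ → Y → ℝ), ∀ᵐ z ∂γ,
      Tendsto (fun n ↦ a n z.1 + b n z.2) atTop (𝓝 (A.indicator (fun _ ↦ (1 : ℝ)) z)) := by
  obtain ⟨f, hf, hlim⟩ := mem_closure_iff_seq_limit.1 (h.indicator_mem_closure hA)
  have hsum (n : ℕ) : ∃ (a : X → ℝ) (b : Y → ℝ), ∀ᵐ z ∂γ, f n z = a z.1 + b z.2 := by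
    obtain ⟨_, ⟨a, rfl⟩, _, ⟨b, rfl⟩, hab⟩ := Submodule.mem_sup.1 (hf n)
    refine ⟨a, b, ?_⟩
    rw [← hab]
    filter_upwards [Lp.coeFn_add (Lp.compMeasurePreservingₗ ℝ _ h.1.measurePreserving_fst a)
        (Lp.compMeasurePreservingₗ ℝ _ h.1.measurePreserving_snd b),
      Lp.coeFn_compMeasurePreserving a h.1.measurePreserving_fst,
      Lp.coeFn_compMeasurePreserving b h.1.measurePreserving_snd] with z h₁ h₂ h₃
    exact h₁.trans (congrArg₂ (· + ·) h₂ h₃)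
  choose a b hab using hsum
  obtain ⟨ns, -, hns⟩ := (tendstoInMeasure_of_tendsto_Lp hlim).exists_seq_tendsto_ae
  refine ⟨fun n ↦ a (ns n), fun n ↦ b (ns n), ?_⟩
  filter_upwards [hns, ae_all_iff.2 hab,
    indicatorConstLp_coeFn (p := 1) (hs := hA) (hμs := measure_ne_top γ A) (c := (1 : ℝ))]
    with z hz hsplit hind
  rw [← hind]
  exact hz.congr fun n ↦ hsplit (ns n)

end Coupling

/-- The alternating sum along a cycle of a limit of sums `a(x) + b(y)` vanishes. -/
lemma sum_cycle_eq_of_tendsto_add {X Y : Type*} {f : X × Y → ℝ} {a : ℕ → X → ℝ} {b : ℕ → Y → ℝ}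
    {S : Set (X × Y)} (hS : ∀ z ∈ S, Tendsto (fun n ↦ a n z.1 + b n z.2) atTop (𝓝 (f z)))
    {k : ℕ} {x : Fin (k + 2) → X} {y : Fin (k + 2) → Y} (h₁ : ∀ i, (x i, y i) ∈ S)
    (h₂ : ∀ i, (x i, y (i + 1)) ∈ S) : ∑ i, f (x i, y i) = ∑ i, f (x i, y (i + 1)) := by
  have hl₁ := tendsto_finsetSum Finset.univ fun i _ ↦ hS _ (h₁ i)
  have hl₂ := tendsto_finsetSum Finset.univ fun i _ ↦ hS _ (h₂ i)
  refine tendsto_nhds_unique hl₁ (hl₂.congr fun n ↦ ?_)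
  simp only [Finset.sum_add_distrib]
  congr 1
  exact Equiv.sum_comp (Equiv.addRight (1 : Fin (k + 2))) fun i ↦ b n (y i)

/-- In a second countable `T₁` space, a point can be separated from the other points of a finite
injective family by a member of the countable basis. -/
lemma exists_mem_countableBasis_forall_mem_iff {X ι : Type*} [TopologicalSpace X] [T1Space X]
    [SecondCountableTopology X] [Finite ι] {x : ι → X} (hx : Function.Injective x) (i : ι) :
    ∃ U ∈ TopologicalSpace.countableBasis X, ∀ j, x j ∈ U ↔ j = i := by
  have hopen : IsOpen (x '' {i}ᶜ)ᶜ := (toFinite (x '' {i}ᶜ)).isClosed.isOpen_compl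
  have hmem : x i ∈ (x '' {i}ᶜ)ᶜ := by
    rintro ⟨j, hj, hji⟩
    exact hj (hx hji)
  obtain ⟨U, hU, hxU, hsub⟩ :=
    (TopologicalSpace.isBasis_countableBasis X).exists_subset_of_mem_open hmem hopen
  refine ⟨U, hU, fun j ↦ ⟨fun hj ↦ ?_, fun hj ↦ hj ▸ hxU⟩⟩
  by_contra hne
  exact hsub hj ⟨j, hne, rfl⟩

/-- **Beneš–Štěpán necessary condition.**  Every extremal measure `γ ∈ Γ(μ,ν)` vanishes
outside some acyclic subset `S ⊆ X × Y`. -/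
theorem extremal_vanishes_outside_acyclic
    {X Y : Type*}
    [MetricSpace X] [TopologicalSpace.SeparableSpace X] [MeasurableSpace X] [BorelSpace X]
    [MetricSpace Y] [TopologicalSpace.SeparableSpace Y] [MeasurableSpace Y] [BorelSpace Y]
    (μ : Measure X) (ν : Measure Y) [IsProbabilityMeasure μ] [IsProbabilityMeasure ν]
    (γ : Measure (X × Y)) (hγ : IsExtremalCoupling γ μ ν) :
    ∃ S : Set (X × Y), Acyclic S ∧ γ Sᶜ = 0 := by
  have := UniformSpace.secondCountable_of_separable X
  have := UniformSpace.secondCountable_of_separable Y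
  have : IsProbabilityMeasure γ := ⟨by
    simpa using hγ.1.measurePreserving_fst.measure_preimage nullMeasurableSet_univ⟩
  have hmeas (p : TopologicalSpace.countableBasis X × TopologicalSpace.countableBasis Y) :
      MeasurableSet ((p.1 : Set X) ×ˢ (p.2 : Set Y)) :=
    (TopologicalSpace.isOpen_of_mem_countableBasis p.1.2).measurableSet.prod
      (TopologicalSpace.isOpen_of_mem_countableBasis p.2.2).measurableSet
  choose a b hab using fun p ↦ hγ.exists_tendsto_add (hmeas p)
  refine ⟨{z | ∀ p, Tendsto (fun n ↦ a p n z.1 + b p n z.2) atTop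
    (𝓝 (((p.1 : Set X) ×ˢ (p.2 : Set Y)).indicator (fun _ ↦ (1 : ℝ)) z))}, ?_,
    ae_all_iff.2 hab⟩
  intro k x y hx hy
  by_contra! hcycle
  obtain ⟨U, hU, hxU⟩ := exists_mem_countableBasis_forall_mem_iff hx 0
  obtain ⟨V, hV, hyV⟩ := exists_mem_countableBasis_forall_mem_iff hy 0
  have hsum := sum_cycle_eq_of_tendsto_add (x := x) (y := y)
    (S := {z | Tendsto (fun n ↦ a (⟨U, hU⟩, ⟨V, hV⟩) n z.1 + b (⟨U, hU⟩, ⟨V, hV⟩) n z.2) atTop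
      (𝓝 ((U ×ˢ V : Set (X × Y)).indicator (fun _ ↦ (1 : ℝ)) z))})
    (fun _ hz ↦ hz) (fun i ↦ (hcycle i).1 (⟨U, hU⟩, ⟨V, hV⟩))
    (fun i ↦ (hcycle i).2 (⟨U, hU⟩, ⟨V, hV⟩))
  have h₁ (i : Fin (k + 2)) :
      (U ×ˢ V : Set (X × Y)).indicator (fun _ ↦ (1 : ℝ)) (x i, y i) = if i = 0 then 1 else 0 := by
    classical
    rw [Set.indicator_apply]
    simp only [mem_prod, hxU, hyV, and_self]
  have h₂ (i : Fin (k + 2)) :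
      (U ×ˢ V : Set (X × Y)).indicator (fun _ ↦ (1 : ℝ)) (x i, y (i + 1)) = 0 := by
    refine indicator_of_notMem (fun hmem ↦ ?_) _
    have h0 : i = 0 := (hxU i).1 hmem.1
    have h1 : i + 1 = 0 := (hyV (i + 1)).1 hmem.2
    rw [h0, zero_add] at h1
    exact one_ne_zero h1
  simp [h₁, h₂] at hsum
end
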